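/- For every n ≥ 16 with n ≡ 4 (mod 12), there exists a synchronizing deterministic finite automaton with n states over a two-letter alphabet possessing a sink state whose reset threshold equals n²/4 + 2n − 9. -/

import Mathlib

/-- The two letters of a binary alphabet. -/
inductive Letter where
  | a : Letter
  | b : Letter
deriving DecidableEq

/-- Extension of a transition function `δ : Q → Letter → Q` to words
(lists of letters), acting on the left: `δ(q, uv) = δ(δ(q, u), v)`. -/
def deltaStar {Q : Type*} (δ : Q → Letter → Q) (q : Q) (w : List Letter) : Q :=
  w.foldl δ q

/-- `w` is a reset word for the automaton with transition function `δ`. -/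
def IsResetWord {Q : Type*} (δ : Q → Letter → Q) (w : List Letter) : Prop :=
  ∀ p q : Q, deltaStar δ p w = deltaStar δ q w

/-- The reset threshold: the minimum length of a reset word. -/
noncomputable def resetThreshold {Q : Type*} (δ : Q → Letter → Q) : ℕ :=
  sInf {l : ℕ | ∃ w : List Letter, IsResetWord δ w ∧ w.length = l}

/-- Action of the letter `a`. States below `k` form a ring, `k`, `k + 1`, `k + 2` are three
special states, `k + 3, …, 2 * k + 2` form a tail and `2 * k + 3` is the sink. -/
def actA (k q : ℕ) : ℕ :=
  if q < k - 4 then q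
  else if q = k - 4 then k - 3
  else if q = k - 3 then k - 4
  else if q = k - 2 then k - 1
  else if q = k - 1 then k + 2
  else if q = k then k + 1
  else if q = k + 1 then k
  else if q = k + 2 then k - 2
  else if q < 2 * k + 3 then q + 1
  else 2 * k + 3

/-- Action of the letter `b`. -/
def actB (k q : ℕ) : ℕ :=
  if q < k - 1 then q + 1
  else if q = k - 1 then 0
  else if q = k then k + 2
  else if q = k + 1 then k + 3
  else if q = k + 2 then k
  else if q < 2 * k + 3 then k + 1
  else 2 * k + 3

/-- The transition function on natural numbers. -/
def step (k q : ℕ) : Letter → ℕ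
  | .a => actA k q
  | .b => actB k q

/-- Result of reading the word `w` from the state `q`. -/
def run (k q : ℕ) (w : List Letter) : ℕ :=
  w.foldl (step k) q

lemma step_lt (k q : ℕ) (ℓ : Letter) : step k q ℓ < 2 * k + 4 := by
  cases ℓ <;> simp only [step, actA, actB] <;> split_ifs <;> omega

/-- The automaton on `2 * k + 4` states. -/
def sinkAutomaton (k : ℕ) (q : Fin (2 * k + 4)) (ℓ : Letter) : Fin (2 * k + 4) :=
  ⟨step k q ℓ, step_lt k q ℓ⟩

lemma val_deltaStar_sinkAutomaton (k : ℕ) (w : List Letter) (q : Fin (2 * k + 4)) :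
    (deltaStar (sinkAutomaton k) q w).val = run k q w := by
  induction w generalizing q with
  | nil => rfl
  | cons ℓ w ih => exact ih (sinkAutomaton k q ℓ)

lemma run_append (k q : ℕ) (u v : List Letter) : run k q (u ++ v) = run k (run k q u) v :=
  List.foldl_append

lemma step_sink (k : ℕ) (ℓ : Letter) : step k (2 * k + 3) ℓ = 2 * k + 3 := by
  cases ℓ <;> simp only [step, actA, actB] <;> split_ifs <;> omega

lemma run_sink (k : ℕ) (w : List Letter) : run k (2 * k + 3) w = 2 * k + 3 := by
  induction w with
  | nil => rfl
  | cons ℓ w ih => rw [run, List.foldl_cons, step_sink]; exact ih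

lemma run_replicate_a (k m q : ℕ) : run k q (List.replicate m .a) = (actA k)^[m] q := by
  induction m generalizing q with
  | zero => rfl
  | succ m ih => exact ih (actA k q)

/-! ### A reset word -/

lemma iterate_actA_six {k q : ℕ} (hk : 6 ≤ k) (hq : q < k + 3) : (actA k)^[6] q = q := by
  have h : q < k - 4 ∨ q = k - 4 ∨ q = k - 3 ∨ q = k - 2 ∨ q = k - 1 ∨ q = k ∨ q = k + 1 ∨
      q = k + 2 := by omega
  obtain ⟨j, rfl⟩ := Nat.exists_eq_add_of_le hk
  rcases h with h | h | h | h | h | h | h | h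
  · have : actA (6 + j) q = q := by simp [actA, h]
    simp [this]
  all_goals
    subst h
    simp [actA]
    grind

lemma iterate_actA_zone {k q : ℕ} (hk : 6 ≤ k) (hd : 6 ∣ k) (hq : q < k + 3) :
    (actA k)^[k] q = q := by
  obtain ⟨j, hj⟩ := hd
  conv_lhs => rw [hj, Function.iterate_mul]
  rw [← hj]
  exact Function.iterate_fixed (iterate_actA_six hk hq) j

lemma iterate_actA_tail {k q : ℕ} (hk : 6 ≤ k) (hq : k + 3 ≤ q) (hq' : q ≤ 2 * k + 3) (m : ℕ) :
    (actA k)^[m] q = min (q + m) (2 * k + 3) := by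
  induction m with
  | zero => simp [hq']
  | succ m ih =>
    rw [Function.iterate_succ_apply', ih]
    simp only [actA]
    split_ifs <;> omega

lemma run_b_pow {k q : ℕ} (hk : 6 ≤ k) (hd : 6 ∣ k) (hq : q < k + 3) :
    run k q (.b :: List.replicate k .a) = if q = k + 1 then 2 * k + 3 else actB k q := by
  change run k (actB k q) _ = _
  rw [run_replicate_a]
  split_ifs with h
  · have : actB k q = k + 3 := by subst h; simp only [actB]; split_ifs <;> omega
    rw [this, iterate_actA_tail hk le_rfl (by omega)]
    omega
  · refine iterate_actA_zone hk hd ?_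
    simp only [actB]; split_ifs <;> omega

lemma run_b_pow_succ {k q : ℕ} (hk : 6 ≤ k) (hd : 6 ∣ k) (hq : q < k + 3) :
    run k q (.b :: List.replicate (k + 1) .a) =
      if q = k + 1 then 2 * k + 3 else actA k (actB k q) := by
  rw [List.replicate_succ', ← List.cons_append, run_append, run_b_pow hk hd hq]
  split_ifs
  · exact run_sink k _
  · rfl

/-- The block repeated in the reset word. -/
def period (k : ℕ) : List Letter :=
  .b :: List.replicate k .a ++ [.b, .b, .a]

lemma run_period {k q : ℕ} (hk : 6 ≤ k) (hd : 6 ∣ k) (hq : q < k + 3) :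
    run k q (period k) =
      if q = k + 1 then 2 * k + 3 else actA k (actB k (actB k (actB k q))) := by
  rw [period, run_append, run_b_pow hk hd hq]
  split_ifs
  · exact run_sink k _
  · rfl

/-- Number of periods after which a state has reached the sink. -/
def depth (k q : ℕ) : ℕ :=
  if k + 3 ≤ q then 0
  else if q = k + 2 then 2
  else if q = k + 1 then 1
  else if q = k then k + 3
  else if q = k - 1 then k + 2 - k / 3
  else if q = k - 2 then k + 2
  else if q = k - 3 then k + 3 - 2 * (k / 3)
  else if q = k - 4 then 3
  else if q % 3 = 0 then k + 2 - 2 * (k / 3) - q / 3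
  else if q % 3 = 1 then k + 1 - q / 3
  else k + 1 - k / 3 - q / 3

lemma actB_iterate_three {k q : ℕ} (hk : 6 ≤ k) (hq : q < k + 3) (h : q ≠ k + 1) :
    actB k (actB k (actB k q)) =
      if q < k - 3 then q + 3 else if q < k then q + 3 - k else if q = k then k + 2 else k := by
  have h' : q < k - 3 ∨ q = k - 3 ∨ q = k - 2 ∨ q = k - 1 ∨ q = k ∨ q = k + 2 := by omega
  obtain ⟨j, rfl⟩ := Nat.exists_eq_add_of_le hk
  rcases h' with h' | h' | h' | h' | h' | h'
  · simp only [actB]; grind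
  all_goals
    subst h'
    simp only [actB]
    grind

lemma depth_ring {k q : ℕ} (hq : q < k - 4) :
    depth k q = if q % 3 = 0 then k + 2 - 2 * (k / 3) - q / 3
      else if q % 3 = 1 then k + 1 - q / 3 else k + 1 - k / 3 - q / 3 := by
  unfold depth
  iterate 8 rw [if_neg (by omega)]

lemma run_period_zone {k q : ℕ} (hk : 6 ≤ k) (hd : 6 ∣ k) (hq : q < k + 3) (h : q ≠ k + 1) :
    run k q (period k) < k + 3 ∧ depth k (run k q (period k)) + 1 = depth k q := by
  rw [run_period hk hd hq, if_neg h, actB_iterate_three hk hq h]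
  obtain ⟨j, rfl⟩ := hd
  have key (e r d : ℕ) (he : (if q < 6 * j - 3 then q + 3 else
      if q < 6 * j then q + 3 - 6 * j else if q = 6 * j then 6 * j + 2 else 6 * j) = e)
      (hr : actA (6 * j) e = r) (hlt : r < 6 * j + 3) (hq : depth (6 * j) q = d + 1)
      (hd : depth (6 * j) r = d) :
      actA (6 * j) (if q < 6 * j - 3 then q + 3 else
        if q < 6 * j then q + 3 - 6 * j else if q = 6 * j then 6 * j + 2 else 6 * j) < 6 * j + 3 ∧
      depth (6 * j) (actA (6 * j) (if q < 6 * j - 3 then q + 3 else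
        if q < 6 * j then q + 3 - 6 * j else if q = 6 * j then 6 * j + 2 else 6 * j)) + 1 =
        depth (6 * j) q := by
    rw [he, hr, hq, hd]
    exact ⟨hlt, rfl⟩
  have h' : q < 6 * j - 7 ∨ q + 7 = 6 * j ∨ q = 6 * j - 6 ∨ q = 6 * j - 5 ∨ q = 6 * j - 4 ∨
    q = 6 * j - 3 ∨ q = 6 * j - 2 ∨ (q = 6 * j - 1 ∧ 1 < j) ∨ (q = 6 * j - 1 ∧ j = 1) ∨
    q = 6 * j ∨ q = 6 * j + 2 := by omega
  rcases h' with h' | h' | h' | h' | h' | h' | h' | h' | h' | h' | h'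
  · refine key (q + 3) (q + 3) _ (if_pos (by omega)) (if_pos (by omega)) (by omega) ?_ rfl
    rw [depth_ring (by omega), depth_ring (by omega)]
    split_ifs <;> omega
  · refine key (6 * j - 4) (6 * j - 3) (2 * j + 3) ?_ ?_ (by omega) ?_ ?_ <;> (try unfold actA) <;>
      (try unfold depth) <;> (repeat first | rw [if_pos (by omega)] | rw [if_neg (by omega)]) <;>
      omega
  · refine key (6 * j - 3) (6 * j - 4) (3) ?_ ?_ (by omega) ?_ ?_ <;> (try unfold actA) <;>
      (try unfold depth) <;> (repeat first | rw [if_pos (by omega)] | rw [if_neg (by omega)]) <;>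
      omega
  · refine key (6 * j - 2) (6 * j - 1) (4 * j + 2) ?_ ?_ (by omega) ?_ ?_ <;> (try unfold actA) <;>
      (try unfold depth) <;> (repeat first | rw [if_pos (by omega)] | rw [if_neg (by omega)]) <;>
      omega
  · refine key (6 * j - 1) (6 * j + 2) (2) ?_ ?_ (by omega) ?_ ?_ <;> (try unfold actA) <;>
      (try unfold depth) <;> (repeat first | rw [if_pos (by omega)] | rw [if_neg (by omega)]) <;>
      omega
  · refine key (0) (0) (2 * j + 2) ?_ ?_ (by omega) ?_ ?_ <;> (try unfold actA) <;>
      (try unfold depth) <;> (repeat first | rw [if_pos (by omega)] | rw [if_neg (by omega)]) <;>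
      omega
  · refine key (1) (1) (6 * j + 1) ?_ ?_ (by omega) ?_ ?_ <;> (try unfold actA) <;>
      (try unfold depth) <;> (repeat first | rw [if_pos (by omega)] | rw [if_neg (by omega)]) <;>
      omega
  · refine key (2) (2) (4 * j + 1) ?_ ?_ (by omega) ?_ ?_ <;> (try unfold actA) <;>
      (try unfold depth) <;> (repeat first | rw [if_pos (by omega)] | rw [if_neg (by omega)]) <;>
      omega
  · refine key (2) (3) (5) ?_ ?_ (by omega) ?_ ?_ <;> (try unfold actA) <;>
      (try unfold depth) <;> (repeat first | rw [if_pos (by omega)] | rw [if_neg (by omega)]) <;>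
      omega
  · refine key (6 * j + 2) (6 * j - 2) (6 * j + 2) ?_ ?_ (by omega) ?_ ?_ <;> (try unfold actA) <;>
      (try unfold depth) <;> (repeat first | rw [if_pos (by omega)] | rw [if_neg (by omega)])
  · refine key (6 * j) (6 * j + 1) (1) ?_ ?_ (by omega) ?_ ?_ <;> (try unfold actA) <;>
      (try unfold depth) <;> (repeat first | rw [if_pos (by omega)] | rw [if_neg (by omega)])

/-- States that can be occupied between two periods. -/
def IsLive (k q : ℕ) : Prop :=
  q < k + 3 ∨ q = 2 * k + 3

lemma run_period_live {k q : ℕ} (hk : 6 ≤ k) (hd : 6 ∣ k) (hq : IsLive k q) :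
    IsLive k (run k q (period k)) ∧ depth k (run k q (period k)) = depth k q - 1 := by
  have hs : depth k (2 * k + 3) = 0 := by simp only [depth]; split_ifs <;> omega
  rcases hq with hq | rfl
  · by_cases h : q = k + 1
    · rw [run_period hk hd hq, if_pos h, hs]
      refine ⟨Or.inr rfl, ?_⟩
      simp [h, depth]
    · obtain ⟨h1, h2⟩ := run_period_zone hk hd hq h
      exact ⟨Or.inl h1, by omega⟩
  · rw [run_sink, hs]
    exact ⟨Or.inr rfl, rfl⟩

lemma run_periods_live {k : ℕ} (hk : 6 ≤ k) (hd : 6 ∣ k) (m : ℕ) {q : ℕ} (hq : IsLive k q) :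
    IsLive k (run k q (List.replicate m (period k)).flatten) ∧
      depth k (run k q (List.replicate m (period k)).flatten) = depth k q - m := by
  induction m generalizing q with
  | zero => exact ⟨hq, rfl⟩
  | succ m ih =>
    obtain ⟨h1, h2⟩ := run_period_live hk hd hq
    rw [List.replicate_succ, List.flatten_cons, run_append]
    obtain ⟨h3, h4⟩ := ih h1
    exact ⟨h3, by omega⟩

lemma eq_of_depth_le_two {k q : ℕ} (hk : 6 ≤ k) (hd : 6 ∣ k) (hq : IsLive k q)
    (h : depth k q ≤ 2) : q = k + 1 ∨ q = k + 2 ∨ q = 2 * k + 3 := by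
  obtain ⟨j, rfl⟩ := hd
  by_contra! hne
  rcases hq with hq | hq
  · simp only [depth] at h
    split_ifs at h <;> omega
  · exact hne.2.2 hq

/-- A shortest reset word. -/
def resetWord (k : ℕ) : List Letter :=
  List.replicate k .a ++ (.b :: List.replicate (k + 1) .a) ++ (.b :: List.replicate (k + 1) .a) ++
    (List.replicate (k - 1) (period k)).flatten ++ (.b :: List.replicate (k + 1) .a) ++
    (.b :: List.replicate k .a)

lemma length_resetWord {k : ℕ} (hk : 6 ≤ k) : (resetWord k).length = k ^ 2 + 8 * k + 3 := by
  obtain ⟨j, rfl⟩ := Nat.exists_eq_add_of_le hk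
  simp [resetWord, period]
  grind

lemma run_opening_blocks {k q : ℕ} (hk : 6 ≤ k) (hd : 6 ∣ k) (hq : q < 2 * k + 4) :
    IsLive k (run k q (List.replicate k .a ++ (.b :: List.replicate (k + 1) .a) ++
      (.b :: List.replicate (k + 1) .a))) ∧
    depth k (run k q (List.replicate k .a ++ (.b :: List.replicate (k + 1) .a) ++
      (.b :: List.replicate (k + 1) .a))) ≤ k + 1 := by
  have hs : IsLive k (2 * k + 3) ∧ depth k (2 * k + 3) ≤ k + 1 :=
    ⟨Or.inr rfl, by simp only [depth]; split_ifs <;> omega⟩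
  rw [run_append, run_append, run_replicate_a]
  by_cases h : q < k + 3
  · rw [iterate_actA_zone hk hd h, run_b_pow_succ hk hd h]
    split_ifs with h1
    · rw [run_sink]; exact hs
    · have h2 : actA k (actB k q) < k + 3 ∧ actA k (actB k q) ≠ k := by
        simp only [actA, actB]; grind
      obtain ⟨h2, h3⟩ := h2
      generalize actA k (actB k q) = r at h2 h3
      rw [run_b_pow_succ hk hd h2]
      split_ifs with h4
      · exact hs
      · have h5 : actA k (actB k r) < k + 3 ∧ actA k (actB k r) ≠ k ∧
            actA k (actB k r) ≠ k - 2 := by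
          simp only [actA, actB]; grind
        obtain ⟨h5, h6, h7⟩ := h5
        generalize actA k (actB k r) = s at h5 h6 h7
        refine ⟨Or.inl h5, ?_⟩
        simp only [depth]
        split_ifs <;> omega
  · rw [iterate_actA_tail hk (by omega) (by omega)]
    have : min (q + k) (2 * k + 3) = 2 * k + 3 := by omega
    rw [this, run_sink, run_sink]
    exact hs

lemma run_resetWord {k q : ℕ} (hk : 6 ≤ k) (hd : 6 ∣ k) (hq : q < 2 * k + 4) :
    run k q (resetWord k) = 2 * k + 3 := by
  obtain ⟨h1, h2⟩ := run_opening_blocks hk hd hq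
  rw [resetWord, run_append, run_append, run_append]
  generalize run k q _ = r at h1 h2
  obtain ⟨h3, h4⟩ := run_periods_live hk hd (k - 1) h1
  generalize run k r _ = s at h3 h4
  rcases eq_of_depth_le_two hk hd h3 (by omega) with rfl | rfl | rfl
  · rw [run_b_pow_succ hk hd (by omega), if_pos rfl, run_sink]
  · have : actA k (actB k (k + 2)) = k + 1 := by simp only [actA, actB]; grind
    rw [run_b_pow_succ hk hd (by omega), if_neg (by omega), this, run_b_pow hk hd (by omega),
      if_pos rfl]
  · rw [run_sink, run_sink]

/-! ### Every reset word is long -/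

/-- Occupation of the states `k - 4, k - 3, k - 2, k - 1, k, k + 1, k + 2`. -/
abbrev Bits := Bool × Bool × Bool × Bool × Bool × Bool × Bool

/-- Occupation after the letter `a`. -/
def moveA : Bits → Bits
  | (p, q, r, s, x, y, z) => (q, p, z, r, y, x, s)

/-- Occupation after the letter `b`, if `i` and `j` tell whether tokens enter at `k - 4` and
`k + 1`. -/
def moveB (i j : Bool) : Bits → Bits
  | (p, q, r, _, x, _, z) => (i, p, q, r, z, j, x)

/-- Number of occupied special states. -/
def count : Bits → ℕ
  | (p, q, r, s, x, y, z) =>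
    p.toNat + q.toNat + r.toNat + s.toNat + x.toNat + y.toNat + z.toNat

/-- Potential of the occupied special states. -/
def potential : Bits → ℕ
  | (p, q, r, s, x, y, z) =>
    [0, 3, 1, 3, 2, 6, 4, 6, 4, 6, 5, 7, 4, 6, 7, 8,
      5, 5, 5, 5, 6, 7, 7, 7, 7, 9, 7, 9, 8, 10, 9, 11,
      6, 7, 6, 7, 6, 8, 6, 8, 8, 10, 10, 11, 8, 10, 10, 12,
      8, 9, 8, 9, 10, 11, 10, 11, 11, 13, 11, 13, 12, 14, 13, 15,
      6, 7, 6, 7, 7, 9, 7, 9, 8, 10, 9, 11, 8, 10, 9, 12,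
      9, 9, 9, 9, 11, 11, 11, 11, 11, 13, 11, 13, 12, 14, 13, 15,
      9, 11, 9, 11, 10, 12, 10, 12, 12, 14, 13, 15, 12, 14, 13, 16,
      12, 13, 12, 13, 14, 15, 14, 15, 15, 17, 15, 17, 16, 18, 17, 19].getD
      (64 * p.toNat + 32 * q.toNat + 16 * r.toNat + 8 * s.toNat + 4 * x.toNat + 2 * y.toNat +
        z.toNat) 0

lemma count_moveA (v : Bits) : count (moveA v) = count v := by
  revert v; decide +kernel

lemma potential_moveA (v : Bits) : potential v ≤ potential (moveA v) + 1 := by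
  revert v; decide +kernel

lemma moveA_iterate_six (v : Bits) : moveA^[6] v = v :=
  rfl

lemma count_moveB (i j : Bool) (v : Bits) :
    count (moveB i j v) + v.2.2.2.1.toNat + v.2.2.2.2.2.1.toNat =
      count v + i.toNat + j.toNat := by
  revert i j v; decide +kernel

lemma potential_moveB (i j : Bool) (v : Bits) :
    potential v + 4 * i.toNat ≤ potential (moveB i j v) + 4 * v.2.2.2.1.toNat + 1 := by
  revert i j v; decide +kernel

lemma potential_eq_zero {v : Bits} (h : count v = 0) : potential v = 0 := by
  revert v; decide +kernel

lemma count_iterate_moveA (t : ℕ) (v : Bits) : count (moveA^[t] v) = count v := by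
  induction t with
  | zero => rfl
  | succ t ih => rw [Function.iterate_succ_apply', count_moveA, ih]

lemma potential_iterate_moveA (t : ℕ) (v : Bits) : potential v ≤ potential (moveA^[t] v) + t := by
  induction t with
  | zero => exact le_rfl
  | succ t ih =>
    rw [Function.iterate_succ_apply']
    have := potential_moveA (moveA^[t] v)
    omega

/-- The states in `O` cover the tokens on ring states `R` and special states `v`. -/
structure Covers (k : ℕ) (O : Set ℕ) (R : Finset ℕ) (v : Bits) : Prop where
  ring_lt : ∀ q ∈ R, q < k - 4
  ring_mem : ∀ q ∈ R, q ∈ O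
  mem_p : v.1 = true → k - 4 ∈ O
  mem_q : v.2.1 = true → k - 3 ∈ O
  mem_r : v.2.2.1 = true → k - 2 ∈ O
  mem_s : v.2.2.2.1 = true → k - 1 ∈ O
  mem_x : v.2.2.2.2.1 = true → k ∈ O
  mem_y : v.2.2.2.2.2.1 = true → k + 1 ∈ O
  mem_z : v.2.2.2.2.2.2 = true → k + 2 ∈ O

lemma mem_image_of_eq {f : ℕ → ℕ} {O : Set ℕ} {q r : ℕ} (h : q ∈ O) (hr : f q = r) :
    r ∈ f '' O :=
  ⟨q, h, hr⟩

lemma Covers.moveA {k : ℕ} {O : Set ℕ} {R : Finset ℕ} {v : Bits} (hk : 6 ≤ k)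
    (h : Covers k O R v) : Covers k (actA k '' O) R (moveA v) where
  ring_lt := h.ring_lt
  ring_mem q hq := mem_image_of_eq (h.ring_mem q hq) (if_pos (h.ring_lt q hq))
  mem_p hv := mem_image_of_eq (h.mem_q hv) (by
    unfold actA; repeat first | rw [if_pos (by omega)] | rw [if_neg (by omega)])
  mem_q hv := mem_image_of_eq (h.mem_p hv) (by
    unfold actA; repeat first | rw [if_pos (by omega)] | rw [if_neg (by omega)])
  mem_r hv := mem_image_of_eq (h.mem_z hv) (by
    unfold actA; repeat first | rw [if_pos (by omega)] | rw [if_neg (by omega)])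
  mem_s hv := mem_image_of_eq (h.mem_r hv) (by
    unfold actA; repeat first | rw [if_pos (by omega)] | rw [if_neg (by omega)])
  mem_x hv := mem_image_of_eq (h.mem_y hv) (by
    unfold actA; repeat first | rw [if_pos (by omega)] | rw [if_neg (by omega)])
  mem_y hv := mem_image_of_eq (h.mem_x hv) (by
    unfold actA; repeat first | rw [if_pos (by omega)] | rw [if_neg (by omega)])
  mem_z hv := mem_image_of_eq (h.mem_s hv) (by
    unfold actA; repeat first | rw [if_pos (by omega)] | rw [if_neg (by omega)])

/-- Ring tokens after the letter `b`, if `s` tells whether a token enters at `0`. -/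
def shift (k : ℕ) (s : Bool) (R : Finset ℕ) : Finset ℕ :=
  (if s then {0} else ∅) ∪ (R.erase (k - 5)).image Nat.succ

lemma card_shift (k : ℕ) (s : Bool) (R : Finset ℕ) :
    (shift k s R).card + (decide (k - 5 ∈ R)).toNat = R.card + s.toNat := by
  have hd : Disjoint (if s then {0} else ∅ : Finset ℕ) ((R.erase (k - 5)).image Nat.succ) := by
    cases s <;> simp
  rw [shift, Finset.card_union_of_disjoint hd, Finset.card_image_of_injective _ Nat.succ_injective]
  by_cases h : k - 5 ∈ R
  · have := Finset.card_erase_add_one h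
    cases s <;> simp [h] <;> omega
  · cases s <;> simp [h] <;> omega

lemma Covers.moveB {k : ℕ} {O : Set ℕ} {R : Finset ℕ} {v : Bits} (hk : 6 ≤ k)
    (h : Covers k O R v) {j : Bool} (hj : j = true → k + 1 ∈ actB k '' O) :
    Covers k (actB k '' O) (shift k v.2.2.2.1 R) (moveB (decide (k - 5 ∈ R)) j v) where
  ring_lt q hq := by
    rcases Finset.mem_union.1 hq with hq | hq
    · have : q = 0 := by split_ifs at hq <;> simp_all
      omega
    · obtain ⟨r, hr, rfl⟩ := Finset.mem_image.1 hq
      obtain ⟨h1, h2⟩ := Finset.mem_erase.1 hr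
      have := h.ring_lt r h2
      omega
  ring_mem q hq := by
    rcases Finset.mem_union.1 hq with hq | hq
    · have : q = 0 ∧ v.2.2.2.1 = true := by split_ifs at hq <;> simp_all
      exact mem_image_of_eq (h.mem_s this.2) (by unfold actB; split_ifs <;> omega)
    · obtain ⟨r, hr, rfl⟩ := Finset.mem_image.1 hq
      obtain ⟨h1, h2⟩ := Finset.mem_erase.1 hr
      have := h.ring_lt r h2
      exact mem_image_of_eq (h.ring_mem r h2) (if_pos (by omega))
  mem_p hv := mem_image_of_eq (h.ring_mem (k - 5) (of_decide_eq_true hv))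
    (by unfold actB; split_ifs <;> omega)
  mem_q hv := mem_image_of_eq (h.mem_p hv) (by unfold actB; split_ifs <;> omega)
  mem_r hv := mem_image_of_eq (h.mem_q hv) (by unfold actB; split_ifs <;> omega)
  mem_s hv := mem_image_of_eq (h.mem_r hv) (by unfold actB; split_ifs <;> omega)
  mem_x hv := mem_image_of_eq (h.mem_z hv) (by unfold actB; split_ifs <;> omega)
  mem_y hv := hj hv
  mem_z hv := mem_image_of_eq (h.mem_x hv) (by unfold actB; split_ifs <;> omega)

/-- The tokens `R`, `v` become covered after `t` further letters `a`, and for `t < k` the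
token in the tail has made `t` steps from its start. -/
structure Tracks (k : ℕ) (O : Set ℕ) (R : Finset ℕ) (v : Bits) (t : ℕ) : Prop where
  le : t ≤ k
  covers : Covers k O R (moveA^[t] v)
  tail : t < k → k + 3 + t ∈ O

/-- Lower bound for the number of letters needed to bring all tokens to the sink. -/
def weight (k : ℕ) (R : Finset ℕ) (v : Bits) (t : ℕ) : ℕ :=
  k * (R.card + count v) + 4 * R.card + potential v + (k - t)

lemma moveA_iterate_of_dvd {k : ℕ} (hd : 6 ∣ k) (v : Bits) : moveA^[k] v = v := by
  obtain ⟨j, rfl⟩ := hd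
  rw [Function.iterate_mul]
  exact Function.iterate_fixed (moveA_iterate_six v) j

lemma Tracks.stepA {k : ℕ} {O : Set ℕ} {R : Finset ℕ} {v : Bits} {t : ℕ} (hk : 6 ≤ k)
    (hd : 6 ∣ k) (h : Tracks k O R v t) :
    ∃ R' v' t', Tracks k (actA k '' O) R' v' t' ∧ weight k R v t ≤ weight k R' v' t' + 1 := by
  have hc := h.covers.moveA hk
  rw [← Function.iterate_succ_apply' moveA] at hc
  rcases h.le.eq_or_lt with rfl | ht
  · refine ⟨R, moveA v, t, ⟨le_rfl, ?_, fun h => absurd h (lt_irrefl _)⟩, ?_⟩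
    · rwa [← Function.iterate_succ_apply moveA]
    · have := potential_moveA v
      simp only [weight, count_moveA]
      omega
  · refine ⟨R, v, t + 1, ⟨ht, hc, fun h' => ?_⟩, ?_⟩
    · exact mem_image_of_eq (h.tail ht) (by unfold actA; split_ifs <;> omega)
    · simp only [weight]
      omega

lemma weight_moveB (k : ℕ) (R : Finset ℕ) (v : Bits) (j : Bool) (t : ℕ) :
    k * (R.card + count v + j.toNat) + 4 * R.card + potential v + (k - t) ≤
      weight k (shift k v.2.2.2.1 R) (moveB (decide (k - 5 ∈ R)) j v) t +
        k * v.2.2.2.2.2.1.toNat + 1 := by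
  have h1 := card_shift k v.2.2.2.1 R
  have h2 := count_moveB (decide (k - 5 ∈ R)) j v
  have h3 := potential_moveB (decide (k - 5 ∈ R)) j v
  have h4 : (shift k v.2.2.2.1 R).card + count (moveB (decide (k - 5 ∈ R)) j v) +
      v.2.2.2.2.2.1.toNat = R.card + count v + j.toNat := by omega
  have h5 := congrArg (k * ·) h4
  simp only [mul_add] at h5
  simp only [weight, mul_add]
  omega

lemma Tracks.stepB {k : ℕ} {O : Set ℕ} {R : Finset ℕ} {v : Bits} {t : ℕ} (hk : 6 ≤ k)
    (hd : 6 ∣ k) (h : Tracks k O R v t) :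
    ∃ R' v' t', Tracks k (actB k '' O) R' v' t' ∧ weight k R v t ≤ weight k R' v' t' + 1 := by
  set u := moveA^[t] v with hu
  have hcount : count u = count v := count_iterate_moveA t v
  have hpot : potential v ≤ potential u + t := potential_iterate_moveA t v
  have hpot' : t = k → potential v = potential u := by
    rintro rfl; rw [hu, moveA_iterate_of_dvd hd]
  have hle := h.le
  have hj : decide (t < k) = true → k + 1 ∈ actB k '' O := fun ht => by
    have ht := of_decide_eq_true ht
    exact mem_image_of_eq (h.tail ht) (by unfold actB; split_ifs <;> omega)
  have hc := h.covers.moveB hk hj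
  have hw := weight_moveB k R u (decide (t < k))
  rw [hcount] at hw
  refine ⟨shift k u.2.2.2.1 R, moveB (decide (k - 5 ∈ R)) (decide (t < k)) u,
    if u.2.2.2.2.2.1 then 0 else k, ⟨?_, ?_, ?_⟩, ?_⟩
  · split_ifs <;> omega
  · split_ifs
    · exact hc
    · rwa [moveA_iterate_of_dvd hd]
  · split_ifs with hy
    · exact fun _ => mem_image_of_eq (h.covers.mem_y hy) (by unfold actB; split_ifs <;> omega)
    · exact fun h => absurd h (lt_irrefl _)
  · unfold weight at hw ⊢
    rcases hle.eq_or_lt with ht | ht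
    · have := hpot' ht
      split_ifs with hy
      · have := hw 0
        simp only [hy, ht, lt_irrefl, decide_false, Bool.toNat_true, Bool.toNat_false, add_zero] at *
        omega
      · have := hw k
        simp only [hy, ht, lt_irrefl, decide_false, Bool.toNat_false, add_zero] at *
        omega
    · split_ifs with hy
      · have := hw 0
        simp only [hy, ht, decide_true, Bool.toNat_true, mul_add] at *
        omega
      · have := hw k
        simp only [hy, ht, decide_true, Bool.toNat_true, Bool.toNat_false, mul_add] at *
        omega

lemma weight_le_length {k : ℕ} (hk : 6 ≤ k) (hd : 6 ∣ k) (w : List Letter) {O : Set ℕ}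
    {R : Finset ℕ} {v : Bits} {t : ℕ} (h : Tracks k O R v t)
    (hw : ∀ q ∈ O, run k q w = 2 * k + 3) : weight k R v t ≤ w.length := by
  induction w generalizing O R v t with
  | nil =>
    have hO (q : ℕ) (hq : q ∈ O) : q = 2 * k + 3 := hw q hq
    have hR : R = ∅ := Finset.eq_empty_of_forall_notMem fun q hq => by
      have := h.covers.ring_lt q hq
      have := hO q (h.covers.ring_mem q hq)
      omega
    have hcount : count (moveA^[t] v) = 0 := by
      obtain ⟨-, -, hp, hq, hr, hs, hx, hy, hz⟩ := h.covers
      generalize moveA^[t] v = u at *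
      obtain ⟨p, q, r, s, x, y, z⟩ := u
      have np : p = false := by by_contra hne; have := hO _ (hp (by simpa using hne)); omega
      have nq : q = false := by by_contra hne; have := hO _ (hq (by simpa using hne)); omega
      have nr : r = false := by by_contra hne; have := hO _ (hr (by simpa using hne)); omega
      have ns : s = false := by by_contra hne; have := hO _ (hs (by simpa using hne)); omega
      have nx : x = false := by by_contra hne; have := hO _ (hx (by simpa using hne)); omega
      have ny : y = false := by by_contra hne; have := hO _ (hy (by simpa using hne)); omega
      have nz : z = false := by by_contra hne; have := hO _ (hz (by simpa using hne)); omega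
      subst np nq nr ns nx ny nz
      rfl
    rw [count_iterate_moveA] at hcount
    have ht : ¬ t < k := fun ht => by
      have := hO _ (h.tail ht)
      omega
    simp [weight, hR, hcount, potential_eq_zero hcount]
    omega
  | cons ℓ w ih =>
    obtain ⟨R', v', t', h', hle⟩ : ∃ R' v' t', Tracks k ((step k · ℓ) '' O) R' v' t' ∧
        weight k R v t ≤ weight k R' v' t' + 1 := by
      cases ℓ
      · exact h.stepA hk hd
      · exact h.stepB hk hd
    have := ih h' (by rintro _ ⟨q, hq, rfl⟩; exact hw q hq)
    rw [List.length_cons]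
    omega

lemma le_length_of_run_eq {k : ℕ} (hk : 6 ≤ k) (hd : 6 ∣ k) {w : List Letter}
    (hw : ∀ q < 2 * k + 4, run k q w = 2 * k + 3) : k ^ 2 + 8 * k + 3 ≤ w.length := by
  have h : Tracks k {q | q < 2 * k + 4} (Finset.range (k - 4))
      (true, true, true, true, true, true, true) 0 := by
    refine ⟨Nat.zero_le _, ⟨fun q hq => Finset.mem_range.1 hq, fun q hq => ?_, ?_, ?_, ?_, ?_, ?_,
      ?_, ?_⟩, ?_⟩
    · have := Finset.mem_range.1 hq
      simp only [Set.mem_ofPred_eq]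
      omega
    all_goals
      intro
      simp only [Set.mem_ofPred_eq]
      omega
  refine le_trans (le_of_eq ?_) (weight_le_length hk hd w h hw)
  obtain ⟨j, rfl⟩ := Nat.exists_eq_add_of_le hk
  simp [weight, count, potential]
  grind

/-- For every `n ≥ 16` with `n ≡ 4 (mod 12)`, there exists a synchronizing
DFA with `n` states over a two-letter alphabet possessing a sink state whose
reset threshold equals `n²/4 + 2n - 9`. -/
theorem exists_slowly_synchronizing_with_sink (n : ℕ) (hn : 16 ≤ n)
    (hmod : n % 12 = 4) :
    ∃ (Q : Type) (_ : Fintype Q) (δ : Q → Letter → Q) (z : Q),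
      Fintype.card Q = n ∧
      (∀ ℓ : Letter, δ z ℓ = z) ∧
      (∃ w : List Letter, IsResetWord δ w) ∧
      resetThreshold δ = n ^ 2 / 4 + 2 * n - 9 := by
  obtain ⟨k, rfl, hk, hd⟩ : ∃ k, n = 2 * k + 4 ∧ 6 ≤ k ∧ 6 ∣ k :=
    ⟨n / 2 - 2, by omega, by omega, by omega⟩
  have hsink (ℓ : Letter) :
      sinkAutomaton k ⟨2 * k + 3, by omega⟩ ℓ = ⟨2 * k + 3, by omega⟩ :=
    Fin.ext (step_sink k ℓ)
  have hreset : IsResetWord (sinkAutomaton k) (resetWord k) := fun p q => by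
    apply Fin.ext
    rw [val_deltaStar_sinkAutomaton, val_deltaStar_sinkAutomaton, run_resetWord hk hd p.2,
      run_resetWord hk hd q.2]
  refine ⟨Fin (2 * k + 4), inferInstance, sinkAutomaton k, ⟨2 * k + 3, by omega⟩,
    Fintype.card_fin _, hsink, ⟨_, hreset⟩, ?_⟩
  have hval : (2 * k + 4) ^ 2 / 4 + 2 * (2 * k + 4) - 9 = k ^ 2 + 8 * k + 3 := by
    have : (2 * k + 4) ^ 2 = (k ^ 2 + 4 * k + 4) * 4 := by ring
    rw [this, Nat.mul_div_cancel _ (by norm_num)]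
    omega
  rw [hval]
  refine le_antisymm (Nat.sInf_le ⟨_, hreset, length_resetWord hk⟩) ?_
  refine le_csInf ⟨_, _, hreset, rfl⟩ ?_
  rintro _ ⟨w, hw, rfl⟩
  refine le_length_of_run_eq hk hd fun q hq => ?_
  have h := congrArg Fin.val (hw ⟨q, hq⟩ ⟨2 * k + 3, by omega⟩)
  rw [val_deltaStar_sinkAutomaton, val_deltaStar_sinkAutomaton, run_sink] at h
  exact h
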